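/- For all integers n ≥ 0, Z_l(n,0) = ((-1)^n/30720)·(105 U₉(n) + 955 U₈(n) + 3095 U₇(n) + 2045 U₆(n) - 12140 U₅(n) - 27300 U₄(n) + 12288 ζ(2)²)·C(2n,n)⁴ + ((-1)^n (4n+1)(5460n⁴ + 13499n³ + 12601n² + 5265n + 831)·C(4n,2n)) / (768 (2n+1)⁹ C(2n,n)⁴), where ζ(2) = π²/6. -/

import Mathlib

open scoped BigOperators

/-- The Pochhammer symbol `(x)_k = x (x+1) ⋯ (x+k-1)` for a real `x`. -/
noncomputable def poch (x : ℝ) (k : ℕ) : ℝ := ∏ i ∈ Finset.range k, (x + i)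

/-- The rational function `R_{n,m}(t)` from the paper. -/
noncomputable def R (n m : ℕ) (t : ℝ) : ℝ :=
  (-1 : ℝ) ^ m * (t + n / 2) * (poch (t - n) m / m.factorial) *
    (poch (t - 2 * n + m) (2 * n - m) / (2 * n - m).factorial) *
    (poch (t + n + 1) n / poch t (n + 1)) *
    (poch (t + n + 1) (2 * n - m) / poch t (2 * n - m + 1)) *
    ((n.factorial : ℝ) / poch t (n + 1)) ^ 2

/-- The rational function `R̃_{n,m}(t)` from the paper. -/
noncomputable def Rtilde (n m : ℕ) (t : ℝ) : ℝ :=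
  ((n.factorial : ℝ) * poch (t - n) (2 * n - m) / (poch t (n + 1) * poch t (2 * n - m + 1))) *
    ∑ j ∈ Finset.range (n + 1),
      (n.choose j : ℝ) ^ 2 * ((2 * n - m + j).choose n : ℝ) * poch (t - j) n / n.factorial

/-- `Z_l(n,m) = -(1/3) Σ_{ν=n-m+1}^∞ (d/dt R_{n,m}(t))|_{t=ν}`. -/
noncomputable def Zl (n m : ℕ) : ℝ :=
  -(1 / 3) * ∑' ν : ℕ, deriv (R n m) ((n : ℝ) - m + 1 + ν)

/-- `Z_r(n,m) = (1/6) Σ_{ν=1}^∞ (d²/dt² R̃_{n,m}(t))|_{t=ν}`. -/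
noncomputable def Zr (n m : ℕ) : ℝ :=
  (1 / 6) * ∑' ν : ℕ, deriv (deriv (Rtilde n m)) (1 + (ν : ℝ))

/-- `U_k(n) = Σ_{i=0}^n C(4i,2i) / ((2i+1)^k C(2i,i)^8)`. -/
noncomputable def U (k n : ℕ) : ℝ :=
  ∑ i ∈ Finset.range (n + 1),
    ((4 * i).choose (2 * i) : ℝ) / ((2 * i + 1) ^ k * ((2 * i).choose i : ℝ) ^ 8)

/-- The harmonic number `S₁(N) = Σ_{i=1}^N 1/i`. -/
noncomputable def S1 (N : ℕ) : ℝ := ∑ i ∈ Finset.range N, (1 : ℝ) / (i + 1)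


open Filter Topology

lemma poch_zero (x : ℝ) : poch x 0 = 1 := by simp [poch]

lemma poch_add (x : ℝ) (a b : ℕ) : poch x (a + b) = poch x a * poch (x + a) b := by
  simp only [poch, Finset.prod_range_add]
  congr 1
  refine Finset.prod_congr rfl fun i _ => ?_
  push_cast
  ring

lemma poch_one (x : ℝ) : poch x 1 = x := by simp [poch]

lemma poch_succ (x : ℝ) (k : ℕ) : poch x (k + 1) = poch x k * (x + k) := by
  rw [poch_add, poch_one]

lemma poch_succ_left (x : ℝ) (k : ℕ) : poch x (k + 1) = x * poch (x + 1) k := by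
  rw [add_comm, poch_add, poch_one, Nat.cast_one]

lemma poch_pos {x : ℝ} (hx : 0 < x) (k : ℕ) : 0 < poch x k :=
  Finset.prod_pos fun i _ => by positivity

/-- `(N+1)_k N! = (N+k)!`. -/
lemma poch_natCast_mul_factorial (N k : ℕ) :
    poch ((N : ℝ) + 1) k * (N.factorial : ℝ) = ((N + k).factorial : ℝ) := by
  induction k with
  | zero => simp [poch_zero]
  | succ k ih =>
    rw [poch_succ, ← add_assoc, Nat.factorial_succ]
    push_cast
    rw [← ih]
    ring

lemma poch_neg_natCast (n : ℕ) : poch (-(n : ℝ)) n = (-1) ^ n * (n.factorial : ℝ) := by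
  induction n with
  | zero => simp [poch_zero]
  | succ n ih =>
    rw [poch_succ_left, show -((n + 1 : ℕ) : ℝ) + 1 = -(n : ℝ) by push_cast; ring, ih,
      Nat.factorial_succ]
    push_cast
    ring

/-- `f` is differentiable on `[1, ∞)`, where it is `O(t^k)` with derivative `O(t^(k-1))`. -/
def HasPowerGrowth (f : ℝ → ℝ) (k : ℤ) : Prop :=
  ∃ C : ℝ, ∀ t : ℝ, 1 ≤ t →
    DifferentiableAt ℝ f t ∧ |f t| ≤ C * t ^ k ∧ |deriv f t| ≤ C * t ^ (k - 1)

namespace HasPowerGrowth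

lemma mono {f : ℝ → ℝ} {k l : ℤ} (hf : HasPowerGrowth f k) (h : k ≤ l) :
    HasPowerGrowth f l := by
  obtain ⟨C, hC⟩ := hf
  have hC0 : 0 ≤ C := by
    have h1 := (hC 1 le_rfl).2.1
    rw [one_zpow, mul_one] at h1
    exact (abs_nonneg _).trans h1
  refine ⟨C, fun t ht => ⟨(hC t ht).1, (hC t ht).2.1.trans ?_, (hC t ht).2.2.trans ?_⟩⟩
  · exact mul_le_mul_of_nonneg_left (zpow_le_zpow_right₀ ht h) hC0
  · exact mul_le_mul_of_nonneg_left (zpow_le_zpow_right₀ ht (by omega)) hC0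

lemma const (c : ℝ) : HasPowerGrowth (fun _ => c) 0 := by
  refine ⟨|c|, fun t ht => ⟨differentiableAt_const c, by simp, ?_⟩⟩
  rw [deriv_const, abs_zero]
  positivity

lemma add_const (a : ℝ) : HasPowerGrowth (fun t => t + a) 1 := by
  refine ⟨1 + |a|, fun t ht => ⟨by fun_prop, ?_, ?_⟩⟩
  · rw [zpow_one]
    have h1 := abs_add_le t a
    rw [abs_of_pos (by linarith : (0 : ℝ) < t)] at h1
    nlinarith [abs_nonneg a]
  · simp

lemma add {f g : ℝ → ℝ} {k : ℤ} (hf : HasPowerGrowth f k) (hg : HasPowerGrowth g k) :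
    HasPowerGrowth (fun t => f t + g t) k := by
  obtain ⟨C, hC⟩ := hf
  obtain ⟨D, hD⟩ := hg
  refine ⟨C + D, fun t ht => ?_⟩
  obtain ⟨h1, h2, h3⟩ := hC t ht
  obtain ⟨h4, h5, h6⟩ := hD t ht
  refine ⟨h1.add h4, ?_, ?_⟩
  · rw [add_mul]
    exact (abs_add_le _ _).trans (add_le_add h2 h5)
  · rw [deriv_fun_add h1 h4, add_mul]
    exact (abs_add_le _ _).trans (add_le_add h3 h6)

lemma mul {f g : ℝ → ℝ} {k l : ℤ} (hf : HasPowerGrowth f k) (hg : HasPowerGrowth g l) :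
    HasPowerGrowth (fun t => f t * g t) (k + l) := by
  obtain ⟨C, hC⟩ := hf
  obtain ⟨D, hD⟩ := hg
  refine ⟨C * D + C * D, fun t ht => ?_⟩
  have ht0 : t ≠ 0 := by linarith
  obtain ⟨h1, h2, h3⟩ := hC t ht
  obtain ⟨h4, h5, h6⟩ := hD t ht
  have e0 : t ^ (k + l) = t ^ k * t ^ l := zpow_add₀ ht0 k l
  have e1 : t ^ (k + l - 1) = t ^ (k - 1) * t ^ l := by
    rw [← zpow_add₀ ht0]; congr 1; ring
  have e2 : t ^ (k + l - 1) = t ^ k * t ^ (l - 1) := by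
    rw [← zpow_add₀ ht0]; congr 1; ring
  refine ⟨h1.mul h4, ?_, ?_⟩
  · have h7 : |f t * g t| ≤ (C * t ^ k) * (D * t ^ l) := by
      rw [abs_mul]
      exact mul_le_mul h2 h5 (abs_nonneg _) ((abs_nonneg _).trans h2)
    have h8 := (abs_nonneg _).trans h7
    rw [e0]
    linarith
  · rw [deriv_fun_mul h1 h4]
    refine (abs_add_le _ _).trans ?_
    rw [abs_mul, abs_mul, add_mul]
    refine add_le_add ?_ ?_
    · rw [e1]
      refine (mul_le_mul h3 h5 (abs_nonneg _) ((abs_nonneg _).trans h3)).trans_eq (by ring)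
    · rw [e2]
      refine (mul_le_mul h2 h6 (abs_nonneg _) ((abs_nonneg _).trans h2)).trans_eq (by ring)

lemma inv_add_const {a : ℝ} (ha : 0 ≤ a) : HasPowerGrowth (fun t => (t + a)⁻¹) (-1) := by
  refine ⟨1, fun t ht => ?_⟩
  have hta : 0 < t + a := by linarith
  have hinv : (t + a)⁻¹ ≤ t⁻¹ := inv_anti₀ (by linarith) (by linarith)
  have hd : HasDerivAt (fun t : ℝ => (t + a)⁻¹) (-1 / (t + a) ^ 2) t :=
    ((hasDerivAt_id' t).add_const a).fun_inv hta.ne'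
  refine ⟨hd.differentiableAt, ?_, ?_⟩
  · rw [abs_of_pos (inv_pos.2 hta), one_mul, zpow_neg_one]
    exact hinv
  · rw [hd.deriv, abs_div, abs_neg, abs_one, abs_of_pos (by positivity), one_mul,
      show (-1 - 1 : ℤ) = -(2 : ℕ) by norm_num, zpow_neg, zpow_natCast, one_div]
    exact inv_anti₀ (by positivity) (pow_le_pow_left₀ (by linarith) (by linarith) 2)

lemma poch_add_const (a : ℝ) (k : ℕ) : HasPowerGrowth (fun t => poch (t + a) k) k := by
  induction k with
  | zero => simpa [poch_zero] using const 1
  | succ k ih =>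
    have h := ih.mul (add_const (a + k))
    simpa [poch_succ, add_assoc] using h

lemma inv_poch (k : ℕ) : HasPowerGrowth (fun t => (poch t k)⁻¹) (-k) := by
  induction k with
  | zero => simpa [poch_zero] using const 1
  | succ k ih =>
    have h := ih.mul (inv_add_const (Nat.cast_nonneg k))
    have e : (-((k + 1 : ℕ) : ℤ)) = -(k : ℤ) + -1 := by push_cast; ring
    rw [e]
    simpa only [poch_succ, mul_inv] using h

lemma pow {f : ℝ → ℝ} {k : ℤ} (hf : HasPowerGrowth f k) (m : ℕ) :
    HasPowerGrowth (fun t => f t ^ m) (m * k) := by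
  induction m with
  | zero => simpa using const 1
  | succ m ih =>
    have h := ih.mul hf
    have e : (((m + 1 : ℕ) : ℤ)) * k = m * k + k := by push_cast; ring
    rw [e]
    simpa only [pow_succ] using h

lemma summable_deriv {f : ℝ → ℝ} (hf : HasPowerGrowth f (-3)) (n : ℕ) :
    Summable fun ν : ℕ => deriv f ((n : ℝ) + 1 + ν) := by
  obtain ⟨C, hC⟩ := hf
  have hs : Summable fun ν : ℕ => C * (1 / (((ν + (n + 1) : ℕ) : ℝ)) ^ 4) :=
    ((summable_nat_add_iff (n + 1)).2
      (Real.summable_one_div_nat_pow.2 (by norm_num : 1 < 4))).mul_left C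
  refine Summable.of_norm_bounded hs fun ν => ?_
  have h := (hC ((n : ℝ) + 1 + ν) (by linarith [(Nat.cast_nonneg n : (0 : ℝ) ≤ n),
    (Nat.cast_nonneg ν : (0 : ℝ) ≤ ν)])).2.2
  rw [show (-3 - 1 : ℤ) = -(4 : ℕ) by norm_num, zpow_neg, zpow_natCast] at h
  rw [Real.norm_eq_abs, one_div]
  rwa [show ((ν + (n + 1) : ℕ) : ℝ) = n + 1 + ν by push_cast; ring]

lemma tendsto_deriv {f : ℝ → ℝ} (hf : HasPowerGrowth f 0) (a : ℝ) :
    Tendsto (fun N : ℕ => deriv f (a + N)) atTop (𝓝 0) := by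
  obtain ⟨C, hC⟩ := hf
  have hlim : Tendsto (fun N : ℕ => a + (N : ℝ)) atTop atTop :=
    tendsto_atTop_add_const_left _ _ tendsto_natCast_atTop_atTop
  have hb : Tendsto (fun N : ℕ => C * (a + (N : ℝ))⁻¹) atTop (𝓝 0) := by
    simpa using (tendsto_inv_atTop_zero.comp hlim).const_mul C
  refine squeeze_zero_norm' ?_ hb
  filter_upwards [hlim.eventually_ge_atTop 1] with N hN
  have h := (hC _ hN).2.2
  rwa [zero_sub, zpow_neg_one] at h

end HasPowerGrowth

/-- The normalising factor `(n!)² / ((2n)! (-1)^n C(2n,n)^4)`. -/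
noncomputable def normFactor (n : ℕ) : ℝ :=
  (n.factorial : ℝ) ^ 2 / ((2 * n).factorial * ((-1 : ℝ) ^ n * ((2 * n).choose n : ℝ) ^ 4))

/-- The very-well-poised form of `R n 0`, divided by `(-1)^n C(2n,n)^4`. -/
noncomputable def normR (n : ℕ) (t : ℝ) : ℝ :=
  normFactor n * (t + n / 2) * poch (t + -(2 * n)) (2 * n) * poch (t + (n + 1)) (2 * n) *
    (poch t (n + 1))⁻¹ ^ 4

/-- The cubic polynomial factor of the telescoping certificate. -/
noncomputable def certPoly (n : ℕ) (t : ℝ) : ℝ :=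
  (((205 * (n : ℝ) ^ 2 + 250 * n + 77) * t
    + (820 * (n : ℝ) ^ 3 + 1205 * n ^ 2 + 558 * n + 77)) * t
    + (1145 * (n : ℝ) ^ 4 + 2045 * n ^ 3 + 1339 * n ^ 2 + 387 * n + 44)) * t
    + (566 * (n : ℝ) ^ 5 + 1240 * n ^ 4 + 1104 * n ^ 3 + 508 * n ^ 2 + 122 * n + 12)

/-- The function whose forward difference in `t` is `normR (n+1) - normR n`. -/
noncomputable def cert (n : ℕ) (t : ℝ) : ℝ :=
  -(normFactor n / (64 * (2 * n + 1) ^ 5)) * certPoly n t * poch (t + -(2 * n + 1)) (2 * n + 1) *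
    poch (t + (n + 1)) (2 * n) * (poch t (n + 1))⁻¹ ^ 4

lemma choose_pos_real (n : ℕ) : (0 : ℝ) < ((2 * n).choose n : ℝ) := by
  exact_mod_cast Nat.choose_pos (by omega)

lemma choose_succ_real (n : ℕ) :
    ((2 * (n + 1)).choose (n + 1) : ℝ)
      = ((2 * n).choose n : ℝ) * (2 * (2 * n + 1)) / (n + 1) := by
  have h := Nat.succ_mul_centralBinom_succ n
  simp only [Nat.centralBinom] at h
  have h' : ((n : ℝ) + 1) * ((2 * (n + 1)).choose (n + 1) : ℝ)
      = 2 * (2 * n + 1) * ((2 * n).choose n : ℝ) := by exact_mod_cast h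
  rw [eq_div_iff (by positivity)]
  linarith

lemma normFactor_succ (n : ℕ) :
    normFactor (n + 1) = -(normFactor n * ((n + 1) / (2 * (2 * n + 1))) ^ 5) := by
  have h := (choose_pos_real n).ne'
  have h1 : ((-1 : ℝ) ^ n) ≠ 0 := by positivity
  unfold normFactor
  rw [choose_succ_real, show 2 * (n + 1) = 2 * n + 1 + 1 by ring, Nat.factorial_succ,
    Nat.factorial_succ, Nat.factorial_succ, pow_succ (-1 : ℝ) n]
  have hf : ((2 * n).factorial : ℝ) ≠ 0 := by positivity
  push_cast
  field_simp
  ring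

lemma R_eq_normR (n : ℕ) {t : ℝ} (ht : 0 < t) :
    R n 0 t = ((-1 : ℝ) ^ n * ((2 * n).choose n : ℝ) ^ 4) * normR n t := by
  have h := (choose_pos_real n).ne'
  have h1 : ((-1 : ℝ) ^ n) ≠ 0 := by positivity
  have hf : ((2 * n).factorial : ℝ) ≠ 0 := by positivity
  have hQ := (poch_pos ht (n + 1)).ne'
  have hX := (poch_pos (show 0 < t + ((n + 1 : ℕ) : ℝ) by positivity) n).ne'
  have e : poch t (2 * n + 1) = poch t (n + 1) * poch (t + ((n + 1 : ℕ) : ℝ)) n := by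
    rw [← poch_add]; congr 1; ring
  unfold R normR normFactor
  simp only [Nat.sub_zero, Nat.cast_zero, add_zero, poch_zero, pow_zero, Nat.factorial_zero,
    Nat.cast_one]
  rw [e]
  rw [show t + (n : ℝ) + 1 = t + ((n + 1 : ℕ) : ℝ) by push_cast; ring,
    show t + ((n : ℝ) + 1) = t + ((n + 1 : ℕ) : ℝ) by push_cast; ring,
    show t - 2 * (n : ℝ) = t + -(2 * n) by ring]
  field_simp

lemma cert_add_one_sub (n : ℕ) {t : ℝ} (ht : 0 < t) :
    normR (n + 1) t - normR n t = cert n (t + 1) - cert n t := by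
  have hQ := (poch_pos ht (n + 1)).ne'
  have hn1 : t + n + 1 ≠ 0 := by positivity
  have eA1 : poch (t + -(2 * ((n + 1 : ℕ) : ℝ))) (2 * (n + 1))
      = (t - 2 * n - 2) * (t - 2 * n - 1) * poch (t + -(2 * n)) (2 * n) := by
    rw [show 2 * (n + 1) = 2 * n + 1 + 1 by ring, poch_succ_left, poch_succ_left]
    push_cast
    ring_nf
  have eA2 : poch (t + -(2 * n + 1)) (2 * n + 1)
      = (t - 2 * n - 1) * poch (t + -(2 * n)) (2 * n) := by
    rw [poch_succ_left]
    ring_nf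
  have eA3 : poch (t + 1 + -(2 * n + 1)) (2 * n + 1) = poch (t + -(2 * n)) (2 * n) * t := by
    rw [poch_succ, show t + 1 + -(2 * (n : ℝ) + 1) = t + -(2 * n) by ring]
    push_cast
    ring
  have eY : poch (t + 1 + (n + 1)) (2 * n)
      = poch (t + (n + 1)) (2 * n) * (t + 3 * n + 1) / (t + n + 1) := by
    rw [eq_div_iff hn1]
    have h1 := poch_succ (t + (n + 1)) (2 * n)
    rw [poch_succ_left] at h1
    rw [show t + 1 + ((n : ℝ) + 1) = t + (n + 1) + 1 by ring]
    push_cast at h1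
    linear_combination h1
  have eY1 : poch (t + (((n + 1 : ℕ) : ℝ) + 1)) (2 * (n + 1))
      = poch (t + (n + 1)) (2 * n) * (t + 3 * n + 1) / (t + n + 1)
        * (t + 3 * n + 2) * (t + 3 * n + 3) := by
    rw [← eY, show 2 * (n + 1) = 2 * n + 1 + 1 by ring, poch_succ, poch_succ]
    push_cast
    ring_nf
  have eQ1 : poch t (n + 1 + 1) = poch t (n + 1) * (t + n + 1) := by
    rw [poch_succ]
    push_cast
    ring
  have eQ2 : poch (t + 1) (n + 1) = poch t (n + 1) * (t + n + 1) / t := by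
    rw [eq_div_iff ht.ne', ← eQ1, poch_succ_left t (n + 1)]
    ring
  unfold normR cert certPoly
  rw [eA1, eA2, eA3, eY, eY1, eQ1, eQ2, normFactor_succ]
  generalize poch (t + -(2 * n)) (2 * n) = A
  generalize poch (t + (n + 1)) (2 * n) = X
  generalize poch t (n + 1) = Q at hQ
  push_cast
  field_simp
  ring

lemma hasPowerGrowth_normR (n : ℕ) : HasPowerGrowth (normR n) (-3) := by
  have h := ((((HasPowerGrowth.const (normFactor n)).mul (HasPowerGrowth.add_const (n / 2))).mul
    (HasPowerGrowth.poch_add_const (-(2 * n)) (2 * n))).mul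
    (HasPowerGrowth.poch_add_const (n + 1) (2 * n))).mul
    ((HasPowerGrowth.inv_poch (n + 1)).pow 4)
  refine HasPowerGrowth.mono h ?_
  push_cast
  linarith

lemma hasPowerGrowth_certPoly (n : ℕ) : HasPowerGrowth (certPoly n) 3 := by
  have ht : HasPowerGrowth (fun t => t) 1 := by simpa using HasPowerGrowth.add_const 0
  have h := fun c => HasPowerGrowth.const c
  exact ((((((h _).mul ht).add ((h _).mono (by norm_num))).mul ht).add
    ((h _).mono (by norm_num))).mul ht).add ((h _).mono (by norm_num))

lemma hasPowerGrowth_cert (n : ℕ) : HasPowerGrowth (cert n) 0 := by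
  have h := ((((HasPowerGrowth.const (-(normFactor n / (64 * (2 * n + 1) ^ 5)))).mul
    (hasPowerGrowth_certPoly n)).mul
    (HasPowerGrowth.poch_add_const (-(2 * n + 1)) (2 * n + 1))).mul
    (HasPowerGrowth.poch_add_const (n + 1) (2 * n))).mul
    ((HasPowerGrowth.inv_poch (n + 1)).pow 4)
  refine HasPowerGrowth.mono h ?_
  push_cast
  linarith

lemma HasPowerGrowth.differentiableAt {f : ℝ → ℝ} {k : ℤ} (hf : HasPowerGrowth f k) {t : ℝ}
    (ht : 1 ≤ t) : DifferentiableAt ℝ f t :=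
  (hf.choose_spec t ht).1

lemma deriv_cert_add_one_sub (n : ℕ) {t : ℝ} (ht : 1 ≤ t) :
    deriv (normR (n + 1)) t - deriv (normR n) t = deriv (cert n) (t + 1) - deriv (cert n) t := by
  have e : (fun s => normR (n + 1) s - normR n s) =ᶠ[𝓝 t]
      fun s => cert n (s + 1) - cert n s := by
    filter_upwards [lt_mem_nhds (show 0 < t by linarith)] with s hs
    exact cert_add_one_sub n hs
  have h1 := e.deriv_eq
  have d : DifferentiableAt ℝ (fun s => cert n (s + 1)) t :=
    DifferentiableAt.fun_comp' t
      ((hasPowerGrowth_cert n).differentiableAt (by linarith : 1 ≤ t + 1)) (by fun_prop)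
  rw [deriv_fun_sub ((hasPowerGrowth_normR _).differentiableAt ht)
    ((hasPowerGrowth_normR _).differentiableAt ht),
    deriv_fun_sub d ((hasPowerGrowth_cert n).differentiableAt ht), deriv_comp_add_const] at h1
  exact h1

/-- The sum of the derivative of `normR n` over the integers greater than `n`. -/
noncomputable def normSum (n : ℕ) : ℝ := ∑' ν : ℕ, deriv (normR n) ((n : ℝ) + 1 + ν)

lemma Zl_eq_normSum (n : ℕ) :
    Zl n 0 = ((-1 : ℝ) ^ n * ((2 * n).choose n : ℝ) ^ 4) * (-(1 / 3) * normSum n) := by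
  unfold Zl normSum
  have e : ∀ ν : ℕ, deriv (R n 0) ((n : ℝ) - (0 : ℕ) + 1 + ν)
      = ((-1 : ℝ) ^ n * ((2 * n).choose n : ℝ) ^ 4) * deriv (normR n) ((n : ℝ) + 1 + ν) := by
    intro ν
    have hpos : (0 : ℝ) < (n : ℝ) + 1 + ν := by positivity
    have h : R n 0 =ᶠ[𝓝 ((n : ℝ) + 1 + ν)]
        fun t => ((-1 : ℝ) ^ n * ((2 * n).choose n : ℝ) ^ 4) * normR n t := by
      filter_upwards [lt_mem_nhds hpos] with s hs
      exact R_eq_normR n hs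
    rw [Nat.cast_zero, sub_zero, h.deriv_eq, deriv_const_mul_field]
  simp_rw [e, tsum_mul_left]
  ring

lemma normSum_succ (n : ℕ) :
    normSum (n + 1) - normSum n
      = -(deriv (cert n) ((n : ℝ) + 1) + deriv (normR (n + 1)) ((n : ℝ) + 1)) := by
  have s0 := (hasPowerGrowth_normR n).summable_deriv n
  have s1 := (hasPowerGrowth_normR (n + 1)).summable_deriv n
  have h1 : ∑' ν : ℕ, deriv (normR (n + 1)) ((n : ℝ) + 1 + ν)
      = deriv (normR (n + 1)) ((n : ℝ) + 1) + normSum (n + 1) := by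
    rw [s1.tsum_eq_zero_add]
    unfold normSum
    push_cast
    rw [add_zero]
    congr 2
    ext ν
    congr 1
    ring
  have hpart : ∀ N : ℕ, ∑ ν ∈ Finset.range N, (deriv (normR (n + 1)) ((n : ℝ) + 1 + ν)
      - deriv (normR n) ((n : ℝ) + 1 + ν))
      = deriv (cert n) ((n : ℝ) + 1 + N) - deriv (cert n) ((n : ℝ) + 1) := by
    intro N
    induction N with
    | zero => simp
    | succ N ih =>
      rw [Finset.sum_range_succ, ih, deriv_cert_add_one_sub n (by
        linarith [(Nat.cast_nonneg n : (0 : ℝ) ≤ n), (Nat.cast_nonneg N : (0 : ℝ) ≤ N)])]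
      push_cast
      rw [add_assoc ((n : ℝ) + 1) N 1]
      ring
  have hlim := (s1.sub s0).hasSum.tendsto_sum_nat
  simp_rw [hpart] at hlim
  have hlim' := ((hasPowerGrowth_cert n).tendsto_deriv ((n : ℝ) + 1)).sub_const
    (deriv (cert n) ((n : ℝ) + 1))
  have h2 := tendsto_nhds_unique hlim hlim'
  rw [s1.tsum_sub s0, h1] at h2
  unfold normSum at h2 ⊢
  linarith

/-- A function that factors as `(t - a) g t` has derivative `g a` at `a`. -/
lemma deriv_of_eq_sub_mul {f g : ℝ → ℝ} {a : ℝ} (h : ∀ t, f t = (t - a) * g t)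
    (hg : DifferentiableAt ℝ g a) : deriv f a = g a := by
  have h1 : HasDerivAt (fun t => (t - a) * g t) (1 * g a + (a - a) * deriv g a) a :=
    ((hasDerivAt_id' a).sub_const a).mul hg.hasDerivAt
  rw [show f = fun t => (t - a) * g t from funext h, h1.deriv]
  ring

lemma poch_factor (n : ℕ) (t : ℝ) :
    poch (t + -(2 * n + 1)) (2 * n + 1)
      = (t - (n + 1)) * (poch (t + -(2 * n + 1)) n * poch (t + -n) n) := by
  rw [show 2 * n + 1 = n + (n + 1) by ring, poch_add, poch_succ_left]
  rw [show t + -(2 * (n : ℝ) + 1) + n = t - (n + 1) by ring,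
    show t - ((n : ℝ) + 1) + 1 = t + -n by ring]
  ring

lemma differentiable_poch_add_const (a : ℝ) (k : ℕ) :
    Differentiable ℝ fun t => poch (t + a) k := by
  unfold poch
  fun_prop

lemma differentiableAt_inv_poch_pow (k : ℕ) (n : ℕ) :
    DifferentiableAt ℝ (fun t => (poch t k)⁻¹ ^ 4) ((n : ℝ) + 1) :=
  ((HasPowerGrowth.inv_poch k).pow 4).differentiableAt
    (by linarith [(Nat.cast_nonneg n : (0 : ℝ) ≤ n)])

lemma factorial_two_mul_real (n : ℕ) :
    ((2 * n).factorial : ℝ) = ((2 * n).choose n : ℝ) * (n.factorial : ℝ) ^ 2 := by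
  have h := Nat.choose_mul_factorial_mul_factorial (show n ≤ 2 * n by omega)
  rw [show 2 * n - n = n by omega] at h
  rw [← h]
  push_cast
  ring

lemma factorial_four_mul_real (n : ℕ) :
    ((4 * n).factorial : ℝ)
      = ((4 * n).choose (2 * n) : ℝ) * (((2 * n).choose n : ℝ) * (n.factorial : ℝ) ^ 2) ^ 2 := by
  have h := factorial_two_mul_real (2 * n)
  rw [show 2 * (2 * n) = 4 * n by ring] at h
  rw [h, factorial_two_mul_real]

lemma normFactor_eq (n : ℕ) :
    normFactor n = (-1 : ℝ) ^ n / ((2 * n).choose n : ℝ) ^ 5 := by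
  have h := (choose_pos_real n).ne'
  have h1 : ((-1 : ℝ) ^ n) ≠ 0 := by positivity
  have h2 : ((-1 : ℝ) ^ n) * (-1) ^ n = 1 := by rw [← mul_pow]; norm_num
  have hf : (n.factorial : ℝ) ≠ 0 := by positivity
  unfold normFactor
  rw [factorial_two_mul_real, div_eq_div_iff (by positivity) (by positivity)]
  linear_combination -((n.factorial : ℝ) ^ 2 * ((2 * n).choose n : ℝ) ^ 5) * h2

lemma poch_zeros_value (n : ℕ) :
    poch ((n : ℝ) + 1 + -(2 * n + 1)) n * poch ((n : ℝ) + 1 + -n) n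
      = (-1) ^ n * (n.factorial : ℝ) ^ 2 := by
  have h := poch_natCast_mul_factorial 0 n
  rw [show (n : ℝ) + 1 + -(2 * n + 1) = -n by ring, poch_neg_natCast,
    show (n : ℝ) + 1 + -n = (0 : ℕ) + 1 by push_cast; ring]
  simp only [Nat.factorial_zero, zero_add, Nat.cast_one, mul_one] at h
  rw [h]
  ring

lemma poch_cert_value (n : ℕ) :
    poch ((n : ℝ) + 1 + (n + 1)) (2 * n)
      = (4 * n + 1) * ((4 * n).choose (2 * n) : ℝ) * ((2 * n).choose n : ℝ)
        * (n.factorial : ℝ) ^ 2 / (2 * n + 1) := by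
  have h := poch_natCast_mul_factorial (2 * n + 1) (2 * n)
  rw [show 2 * n + 1 + 2 * n = 4 * n + 1 by ring, Nat.factorial_succ, Nat.factorial_succ] at h
  push_cast at h
  rw [factorial_four_mul_real, factorial_two_mul_real] at h
  have hD := (choose_pos_real n).ne'
  have hf : (n.factorial : ℝ) ≠ 0 := by positivity
  rw [show (n : ℝ) + 1 + (n + 1) = 2 * n + 1 + 1 by ring, eq_div_iff (by positivity)]
  apply mul_right_cancel₀ (mul_ne_zero hD (pow_ne_zero 2 hf))
  linear_combination h

lemma poch_normR_succ_value (n : ℕ) :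
    poch ((n : ℝ) + 1 + ((n + 1 : ℕ) + 1)) (2 * (n + 1))
      = 4 * (4 * n + 1) * (4 * n + 3) * ((4 * n).choose (2 * n) : ℝ) * ((2 * n).choose n : ℝ)
        * (n.factorial : ℝ) ^ 2 := by
  have h := poch_natCast_mul_factorial (2 * n + 2) (2 * n + 2)
  rw [show 2 * n + 2 + (2 * n + 2) = 4 * n + 1 + 1 + 1 + 1 by ring,
    Nat.factorial_succ (4 * n + 1 + 1 + 1), Nat.factorial_succ (4 * n + 1 + 1),
    Nat.factorial_succ (4 * n + 1),
    Nat.factorial_succ (4 * n), Nat.factorial_succ (2 * n + 1), Nat.factorial_succ] at h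
  push_cast at h
  rw [factorial_four_mul_real, factorial_two_mul_real] at h
  have hD := (choose_pos_real n).ne'
  have hf : (n.factorial : ℝ) ≠ 0 := by positivity
  have h1 : (2 * (n : ℝ) + 1) * (2 * n + 2) ≠ 0 := by positivity
  rw [show (n : ℝ) + 1 + ((n + 1 : ℕ) + 1) = 2 * n + 2 + 1 by push_cast; ring,
    show 2 * (n + 1) = 2 * n + 2 by ring]
  apply mul_right_cancel₀ (mul_ne_zero h1 (mul_ne_zero hD (pow_ne_zero 2 hf)))
  linear_combination h

lemma poch_denominator_value (n : ℕ) :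
    poch ((n : ℝ) + 1) (n + 1) = (2 * n + 1) * ((2 * n).choose n : ℝ) * (n.factorial : ℝ) := by
  have h := poch_natCast_mul_factorial n (n + 1)
  rw [show n + (n + 1) = 2 * n + 1 by ring, Nat.factorial_succ] at h
  push_cast at h
  rw [factorial_two_mul_real] at h
  have hf : (n.factorial : ℝ) ≠ 0 := by positivity
  apply mul_right_cancel₀ hf
  linear_combination h

lemma deriv_cert_value (n : ℕ) :
    deriv (cert n) ((n : ℝ) + 1)
      = -(certPoly n (n + 1) * (4 * n + 1) * ((4 * n).choose (2 * n) : ℝ)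
        / (64 * (2 * n + 1) ^ 10 * ((2 * n).choose n : ℝ) ^ 8)) := by
  have hc : DifferentiableAt ℝ (certPoly n) ((n : ℝ) + 1) :=
    (hasPowerGrowth_certPoly n).differentiableAt (by linarith [(Nat.cast_nonneg n : (0 : ℝ) ≤ n)])
  rw [deriv_of_eq_sub_mul (g := fun t => -(normFactor n / (64 * (2 * n + 1) ^ 5)) *
    certPoly n t * (poch (t + -(2 * n + 1)) n * poch (t + -n) n) *
    poch (t + (n + 1)) (2 * n) * (poch t (n + 1))⁻¹ ^ 4)
    (fun t => by unfold cert; rw [poch_factor]; ring)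
    (((((differentiableAt_const _).mul hc).mul
      ((differentiable_poch_add_const _ _ _).mul (differentiable_poch_add_const _ _ _))).mul
      (differentiable_poch_add_const _ _ _)).mul (differentiableAt_inv_poch_pow _ _))]
  have hD := (choose_pos_real n).ne'
  have hf : (n.factorial : ℝ) ≠ 0 := by positivity
  have h2 : ((-1 : ℝ) ^ n) ^ 2 = 1 := by rw [← pow_mul, mul_comm, pow_mul]; norm_num
  simp only [poch_zeros_value, poch_cert_value, poch_denominator_value, normFactor_eq]
  field_simp
  rw [h2, one_mul]

lemma deriv_normR_succ_value (n : ℕ) :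
    deriv (normR (n + 1)) ((n : ℝ) + 1)
      = 3 * (n + 1) ^ 3 * (4 * n + 1) * (4 * n + 3) * ((4 * n).choose (2 * n) : ℝ)
        / (256 * (2 * n + 1) ^ 9 * ((2 * n).choose n : ℝ) ^ 8) := by
  rw [deriv_of_eq_sub_mul (g := fun t => normFactor (n + 1) * (t + (n + 1 : ℕ) / 2) *
    (t - 2 * n - 2) * (poch (t + -(2 * n + 1)) n * poch (t + -n) n) *
    poch (t + ((n + 1 : ℕ) + 1)) (2 * (n + 1)) * (poch t (n + 1 + 1))⁻¹ ^ 4)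
    (fun t => by
      unfold normR
      have e : poch (t + -(2 * ((n + 1 : ℕ) : ℝ))) (2 * (n + 1))
          = (t - 2 * n - 2) * poch (t + -(2 * n + 1)) (2 * n + 1) := by
        rw [show 2 * (n + 1) = 2 * n + 1 + 1 by ring, poch_succ_left]
        push_cast
        ring_nf
      rw [e, poch_factor]
      ring)
    ((((DifferentiableAt.mul (by fun_prop) (by fun_prop)).mul
      ((differentiable_poch_add_const _ _ _).mul (differentiable_poch_add_const _ _ _))).mul
      (differentiable_poch_add_const _ _ _)).mul (differentiableAt_inv_poch_pow _ _))]
  have hD := (choose_pos_real n).ne'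
  have hf : (n.factorial : ℝ) ≠ 0 := by positivity
  have h2 : ((-1 : ℝ) ^ n) ^ 2 = 1 := by rw [← pow_mul, mul_comm, pow_mul]; norm_num
  simp only [poch_zeros_value, poch_normR_succ_value, poch_succ _ (n + 1),
    poch_denominator_value, normFactor_succ, normFactor_eq]
  push_cast
  rw [show (n : ℝ) + 1 + (n + 1) = 2 * (n + 1) by ring]
  field_simp
  rw [h2]
  ring

lemma normSum_zero : normSum 0 = -3 * (Real.pi ^ 4 / 90) := by
  have e : normR 0 = fun t : ℝ => (t ^ 3)⁻¹ := by
    ext t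
    rcases eq_or_ne t 0 with rfl | ht
    · simp [normR]
    · simp [normR, normFactor, poch_zero, poch_one]
      field_simp
  have hd : ∀ ν : ℕ, deriv (normR 0) (((0 : ℕ) : ℝ) + 1 + ν)
      = -3 * (1 / ((ν + 1 : ℕ) : ℝ) ^ 4) := by
    intro ν
    have hν : (((0 : ℕ) : ℝ) + 1 + ν) ≠ 0 := by positivity
    rw [e, ((hasDerivAt_pow 3 (((0 : ℕ) : ℝ) + 1 + ν)).fun_inv (pow_ne_zero 3 hν)).deriv]
    have hν' : (ν : ℝ) + 1 ≠ 0 := by positivity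
    push_cast
    rw [zero_add, add_comm (1 : ℝ) ν]
    field_simp
  unfold normSum
  simp_rw [hd]
  rw [tsum_mul_left, ← hasSum_zeta_four.tsum_eq, hasSum_zeta_four.summable.tsum_eq_zero_add]
  simp

lemma U_succ (k n : ℕ) :
    U k (n + 1) = U k n + ((4 * (n + 1)).choose (2 * (n + 1)) : ℝ)
      / ((2 * n + 3) ^ k * ((2 * (n + 1)).choose (n + 1) : ℝ) ^ 8) := by
  unfold U
  rw [Finset.sum_range_succ _ (n + 1)]
  push_cast
  ring_nf

lemma choose_four_succ_real (n : ℕ) :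
    ((4 * (n + 1)).choose (2 * (n + 1)) : ℝ)
      = ((4 * n).choose (2 * n) : ℝ) * (2 * (4 * n + 1) * (4 * n + 3))
        / ((2 * n + 1) * (n + 1)) := by
  have h1 := choose_succ_real (2 * n)
  have h2 := choose_succ_real (2 * n + 1)
  rw [h1, show 2 * (2 * n + 1 + 1) = 4 * (n + 1) by ring,
    show 2 * n + 1 + 1 = 2 * (n + 1) by ring, show 2 * (2 * n) = 4 * n by ring] at h2
  rw [h2]
  push_cast
  field_simp
  ring

lemma normSum_closed_form (n : ℕ) :
    -(1 / 3) * normSum n =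
      1 / 30720 *
        (105 * U 9 n + 955 * U 8 n + 3095 * U 7 n + 2045 * U 6 n
          - 12140 * U 5 n - 27300 * U 4 n + 12288 * (Real.pi ^ 2 / 6) ^ 2)
      + (4 * (n : ℝ) + 1) *
          (5460 * (n : ℝ) ^ 4 + 13499 * (n : ℝ) ^ 3 + 12601 * (n : ℝ) ^ 2
            + 5265 * (n : ℝ) + 831) * ((4 * n).choose (2 * n) : ℝ) /
          (768 * (2 * (n : ℝ) + 1) ^ 9 * ((2 * n).choose n : ℝ) ^ 8) := by
  induction n with
  | zero =>
    rw [normSum_zero]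
    simp [U]
    ring
  | succ n ih =>
    have hs := normSum_succ n
    rw [deriv_cert_value, deriv_normR_succ_value] at hs
    rw [eq_add_of_sub_eq hs, mul_add, ih]
    simp only [U_succ, choose_four_succ_real, choose_succ_real]
    have hD := (choose_pos_real n).ne'
    generalize ((2 * n).choose n : ℝ) = D at hD
    generalize ((4 * n).choose (2 * n) : ℝ) = E
    unfold certPoly
    have h1 : (2 * (n : ℝ) + 1) ≠ 0 := by positivity
    have h3 : (2 * (n : ℝ) + 3) ≠ 0 := by positivity
    have h4 : (n : ℝ) + 1 ≠ 0 := by positivity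
    push_cast
    rw [show 2 * ((n : ℝ) + 1) + 1 = 2 * n + 3 by ring]
    field_simp
    ring

/-- The closed form for `Z_l(n,0)` in terms of `ζ(2)²` and the sums `U_k(n)`. -/
theorem Zl_n_zero_closed_form (n : ℕ) :
    Zl n 0 =
      (-1 : ℝ) ^ n / 30720 *
        (105 * U 9 n + 955 * U 8 n + 3095 * U 7 n + 2045 * U 6 n
          - 12140 * U 5 n - 27300 * U 4 n + 12288 * (Real.pi ^ 2 / 6) ^ 2) *
        ((2 * n).choose n : ℝ) ^ 4
      + (-1 : ℝ) ^ n * (4 * (n : ℝ) + 1) *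
          (5460 * (n : ℝ) ^ 4 + 13499 * (n : ℝ) ^ 3 + 12601 * (n : ℝ) ^ 2
            + 5265 * (n : ℝ) + 831) * ((4 * n).choose (2 * n) : ℝ) /
          (768 * (2 * (n : ℝ) + 1) ^ 9 * ((2 * n).choose n : ℝ) ^ 4) := by
  rw [Zl_eq_normSum, normSum_closed_form]
  have hD := (choose_pos_real n).ne'
  field_simp
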